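/- arXiv:1309.0938 — 2 statements merged into one kernel-verified Lean document; each statement's English description precedes it below -/
import Mathlib

section
/- Let 0 = r_0 < r_1 < ... < r_m < ... be an infinite strictly increasing sequence of real numbers, let n ≥ 1, s ≥ 1, and let P_0,...,P_n ∈ ℝ^s. Define the dimension elevation scheme by P^0_i = P_i for i = 0,...,n and, for j ≥ 1: P^j_0 = P^{j−1}_0, P^j_{n+j} = P^{j−1}_{n+j−1}, and P^j_i = (r_i/r_{n+j}) P^{j−1}_{i−1} + (1 − r_i/r_{n+j}) P^{j−1}_i for i = 1,...,n+j−1. Then for every j ≥ 0 and every t ∈ [0,1], ∑_{k=0}^n H^n_{k,Λ_n}(t) P_k = ∑_{k=0}^{n+j} H^{n+j}_{k,Λ_{n+j}}(t) P^j_k, where Λ_m = (r_0,...,r_m). -/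
open Filter Topology

/-- Divided difference of `g` at the `n+1` points `x 0, ..., x n`. -/
noncomputable def divDiff (g : ℝ → ℝ) : (n : ℕ) → (Fin (n+1) → ℝ) → ℝ
  | 0, x => g (x 0)
  | n+1, x => (divDiff g n (fun i => x i.succ) - divDiff g n (fun i => x i.castSucc)) /
      (x (Fin.last (n+1)) - x 0)

/-- Gelfond–Bernstein basis function `H^n_{k,Λ_n}` on `[0,1]` for the exponent sequence `r`.
Here `t ^ x` is the real power `Real.rpow`, so that for `t = 0` it agrees with the
function `f_0` of the paper: `0 ^ 0 = 1` and `0 ^ x = 0` for `x > 0`. -/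
noncomputable def gelfond (r : ℕ → ℝ) (n k : ℕ) (t : ℝ) : ℝ :=
  if k = n then t ^ (r n)
  else (-1 : ℝ)^(n-k) * (∏ j ∈ Finset.Icc (k+1) n, r j) *
    divDiff (fun x => t ^ x) (n-k) (fun i => r (k + i.val))

/-- The dimension elevation scheme: `dimElev r n P j i` is the point `P^j_i` obtained from the
initial polygon `P^0_i = P i`, `i = 0, ..., n`, by `j` elevation steps with respect to the
exponent sequence `r`. -/
noncomputable def dimElev {E : Type*} [AddCommGroup E] [Module ℝ E]
    (r : ℕ → ℝ) (n : ℕ) (P : ℕ → E) : ℕ → ℕ → E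
  | 0, i => P i
  | j+1, i =>
    if i = 0 then dimElev r n P j 0
    else if i = n + j + 1 then dimElev r n P j (n + j)
    else (r i / r (n + j + 1)) • dimElev r n P j (i - 1) +
      (1 - r i / r (n + j + 1)) • dimElev r n P j i

/-- The Gelfond–Bernstein function in offset form; the case `k = n` needs no separate treatment. -/
theorem gelfond_add (r : ℕ → ℝ) (k d : ℕ) (t : ℝ) :
    gelfond r (k + d) k t = (-1 : ℝ) ^ d * (∏ j ∈ Finset.Icc (k + 1) (k + d), r j) *
      divDiff (fun x => t ^ x) d (fun i => r (k + i.val)) := by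
  rcases d with _ | d
  · simp [gelfond, divDiff]
  · rw [gelfond, if_neg (by omega)]
    generalize he : k + (d + 1) - k = e
    obtain rfl : e = d + 1 := by omega
    rfl

theorem divDiff_shift_succ (g : ℝ → ℝ) (r : ℕ → ℝ) (k d : ℕ) (h : r (k + d + 1) ≠ r k) :
    (r (k + d + 1) - r k) * divDiff g (d + 1) (fun i => r (k + i.val)) =
      divDiff g d (fun i => r (k + 1 + i.val)) - divDiff g d (fun i => r (k + i.val)) := by
  have h' : r (k + d + 1) - r k ≠ 0 := sub_ne_zero.mpr h
  have hs : (fun i : Fin (d + 1) => r (k + (i.val + 1))) = fun i => r (k + 1 + i.val) := by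
    funext i
    congr 1
    omega
  simp only [divDiff, Fin.val_succ, Fin.val_castSucc, Fin.val_last, Fin.val_zero, add_zero,
    ← add_assoc k d 1, hs]
  field_simp

/-- Each Gelfond–Bernstein function of order `m` is a combination of two of order `m + 1`. -/
theorem gelfond_eq_add_succ {r : ℕ → ℝ} (hr0 : r 0 = 0) (hmono : StrictMono r)
    {m k : ℕ} (hk : k ≤ m) (t : ℝ) :
    gelfond r m k t = (1 - r k / r (m + 1)) * gelfond r (m + 1) k t +
      r (k + 1) / r (m + 1) * gelfond r (m + 1) (k + 1) t := by
  obtain ⟨d, rfl⟩ := Nat.exists_eq_add_of_le hk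
  have hR : r (k + d + 1) ≠ 0 := by
    rw [← hr0]
    exact (hmono (by omega)).ne'
  have hD := divDiff_shift_succ (fun x => t ^ x) r k d (hmono (by omega)).ne'
  have e₁ := gelfond_add r k (d + 1) t
  have e₂ := gelfond_add r (k + 1) d t
  rw [← add_assoc k d 1, Finset.prod_Icc_succ_top (by omega)] at e₁
  rw [show k + 1 + d = k + d + 1 by omega] at e₂
  have hprod : (∏ j ∈ Finset.Icc (k + 1) (k + d), r j) * r (k + d + 1) =
      r (k + 1) * ∏ j ∈ Finset.Icc (k + 1 + 1) (k + d + 1), r j := by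
    rw [← Finset.prod_Icc_succ_top (by omega),
      ← Finset.mul_prod_Ioc_eq_prod_Icc (show k + 1 ≤ k + d + 1 by omega)]
    congr 2
    ext x
    simp
  rw [e₁, e₂, gelfond_add r k d t]
  field_simp
  rw [pow_succ]
  linear_combination (-1 : ℝ) ^ d * (∏ j ∈ Finset.Icc (k + 1) (k + d), r j) * r (k + d + 1) * hD +
    (-1 : ℝ) ^ d * divDiff (fun x => t ^ x) d (fun i => r (k + 1 + i.val)) * hprod

/-- The two endpoint rules are instances of the interior rule of the scheme. -/
theorem dimElev_succ {E : Type*} [AddCommGroup E] [Module ℝ E] {r : ℕ → ℝ} (hr0 : r 0 = 0)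
    (hmono : StrictMono r) (n : ℕ) (P : ℕ → E) (j i : ℕ) :
    dimElev r n P (j + 1) i = (r i / r (n + j + 1)) • dimElev r n P j (i - 1) +
      (1 - r i / r (n + j + 1)) • dimElev r n P j i := by
  rw [dimElev]
  split_ifs with h₀ h₁
  · simp [h₀, hr0]
  · have hR : r (n + j + 1) ≠ 0 := by
      rw [← hr0]
      exact (hmono (by omega)).ne'
    simp [h₁, div_self hR]
  · rfl

theorem sum_gelfond_smul_dimElev_succ {E : Type*} [AddCommGroup E] [Module ℝ E] {r : ℕ → ℝ}
    (hr0 : r 0 = 0) (hmono : StrictMono r) (n : ℕ) (P : ℕ → E) (j : ℕ) (t : ℝ) :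
    ∑ k ∈ Finset.range (n + j + 1), gelfond r (n + j) k t • dimElev r n P j k =
      ∑ k ∈ Finset.range (n + j + 1 + 1),
        gelfond r (n + j + 1) k t • dimElev r n P (j + 1) k := by
  have hR : r (n + j + 1) ≠ 0 := by
    rw [← hr0]
    exact (hmono (by omega)).ne'
  simp only [dimElev_succ hr0 hmono, smul_add, Finset.sum_add_distrib]
  rw [Finset.sum_range_succ' (fun k => gelfond r (n + j + 1) k t •
      (r k / r (n + j + 1)) • dimElev r n P j (k - 1)),
    Finset.sum_range_succ (fun k => gelfond r (n + j + 1) k t •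
      (1 - r k / r (n + j + 1)) • dimElev r n P j k)]
  simp only [hr0, zero_div, zero_smul, smul_zero, add_zero, div_self hR, sub_self,
    Nat.add_sub_cancel]
  rw [← Finset.sum_add_distrib]
  refine Finset.sum_congr rfl fun k hk => ?_
  rw [gelfond_eq_add_succ hr0 hmono (Nat.lt_succ_iff.mp (Finset.mem_range.mp hk))]
  module

/-- The dimension elevation scheme reproduces the Gelfond–Bézier curve: for all `j ≥ 0` and
`t ∈ [0,1]`, `∑_{k=0}^n H^n_{k,Λ_n}(t) P_k = ∑_{k=0}^{n+j} H^{n+j}_{k,Λ_{n+j}}(t) P^j_k`. -/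
theorem dimElev_invariance (r : ℕ → ℝ) (hr0 : r 0 = 0) (hmono : StrictMono r)
    (n s : ℕ) (hn : 1 ≤ n) (hs : 1 ≤ s) (P : ℕ → EuclideanSpace ℝ (Fin s)) :
    ∀ j : ℕ, ∀ t ∈ Set.Icc (0:ℝ) 1,
      ∑ k ∈ Finset.range (n + 1), gelfond r n k t • P k =
        ∑ k ∈ Finset.range (n + j + 1), gelfond r (n + j) k t • dimElev r n P j k := by
  intro j t ht
  induction j with
  | zero => simp [dimElev]
  | succ j ih => rw [ih, sum_gelfond_smul_dimElev_succ hr0 hmono, add_assoc n j 1]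
end

section
/- Let 0 = r_0 < r_1 < ... < r_n be real numbers, Λ_n = (r_0,...,r_n), 0 < a < 1, and let (B_0,...,B_n) be the Chebyshev–Bernstein basis of E(Λ_n) on [a,1] (functions in E(Λ_n) with ∑_k B_k ≡ 1 on [a,1], B_k^{(j)}(a) = 0 for 0 ≤ j ≤ k−1, B_k^{(j)}(1) = 0 for 0 ≤ j ≤ n−k−1). Then for each i ∈ {0,...,n} there exist real numbers s^{(i)}_0,...,s^{(i)}_n ∈ [0,1] with ∑_{j=0}^n s^{(i)}_j = 1 such that: for every s ≥ 1 and all points P_0,...,P_n ∈ ℝ^s and b_0,...,b_n ∈ ℝ^s satisfying ∑_{k=0}^n H^n_{k,Λ_n}(t) P_k = ∑_{k=0}^n B_k(t) b_k for all t ∈ [a,1], one has b_i = ∑_{j=0}^n s^{(i)}_j P_j. -/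
open Filter Topology

/-- `f` belongs to the Müntz space `E(Λ_n) = span(t^{r_0}, t^{r_1}, ..., t^{r_n})`
(as a function of `t > 0`, where `t ^ r` is the real power). -/
def InMuntz (r : ℕ → ℝ) (n : ℕ) (f : ℝ → ℝ) : Prop :=
  ∃ c : ℕ → ℝ, ∀ t : ℝ, 0 < t → f t = ∑ j ∈ Finset.range (n + 1), c j * t ^ r j

/-- `B 0, ..., B n` is the Chebyshev–Bernstein basis of the Müntz space `E(Λ_n)` on `[a,b]`:
the functions belong to `E(Λ_n)`, sum to `1` on `[a,b]`, `B k` has a zero of order `k` at `a`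
(derivatives of order `j ≤ k - 1` vanish) and a zero of order `n - k` at `b`
(derivatives of order `j ≤ n - k - 1` vanish). -/
def IsChebBernstein (r : ℕ → ℝ) (n : ℕ) (a b : ℝ) (B : ℕ → ℝ → ℝ) : Prop :=
  (∀ k ≤ n, InMuntz r n (B k)) ∧
  (∀ t ∈ Set.Icc a b, ∑ k ∈ Finset.range (n + 1), B k t = 1) ∧
  (∀ k ≤ n, ∀ j < k, iteratedDeriv j (B k) a = 0) ∧
  (∀ k ≤ n, ∀ j < n - k, iteratedDeriv j (B k) b = 0)

/-- The `m`-th derivative at `u` of the exponential sum `u ↦ ∑_{j ≤ n} c_j exp (r_j u)`. -/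
noncomputable def expSum (r c : ℕ → ℝ) (n m : ℕ) (u : ℝ) : ℝ :=
  ∑ j ∈ Finset.range (n + 1), c j * r j ^ m * Real.exp (r j * u)

section ExpSum

variable {r : ℕ → ℝ} {n : ℕ}

lemma lt_of_step_lt (hr : ∀ i < n, r i < r (i + 1)) {i j : ℕ} (hij : i < j) (hj : j ≤ n) :
    r i < r j := by
  induction j, hij using Nat.le_induction with
  | base => exact hr i hj
  | succ j hij ih => exact (ih (by omega)).trans (hr j (by omega))

lemma hasDerivAt_expSum (c : ℕ → ℝ) (m : ℕ) (u : ℝ) :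
    HasDerivAt (expSum r c n m) (expSum r c n (m + 1) u) u := by
  unfold expSum
  refine HasDerivAt.fun_sum fun j _ => ?_
  have h := (((hasDerivAt_id' u).const_mul (r j)).exp).const_mul (c j * r j ^ m)
  exact h.congr_deriv (by ring)

lemma continuous_expSum (c : ℕ → ℝ) (m : ℕ) : Continuous (expSum r c n m) :=
  continuous_iff_continuousAt.2 fun u => (hasDerivAt_expSum c m u).continuousAt

lemma expSum_sub_mul (c d : ℕ → ℝ) (x : ℝ) (m : ℕ) (u : ℝ) :
    expSum r (fun p => c p - x * d p) n m u = expSum r c n m u - x * expSum r d n m u := by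
  simp only [expSum, Finset.mul_sum, ← Finset.sum_sub_distrib]
  exact Finset.sum_congr rfl fun _ _ => by ring

lemma expSum_sum_mul (S : Finset ℕ) (x : ℕ → ℝ) (b : ℕ → ℕ → ℝ) (m : ℕ) (u : ℝ) :
    expSum r (fun p => ∑ i ∈ S, x i * b i p) n m u = ∑ i ∈ S, x i * expSum r (b i) n m u := by
  simp only [expSum, Finset.mul_sum, Finset.sum_mul]
  rw [Finset.sum_comm]
  exact Finset.sum_congr rfl fun _ _ => Finset.sum_congr rfl fun _ _ => by ring

lemma expSum_neg (c : ℕ → ℝ) (m : ℕ) (u : ℝ) :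
    expSum r (fun p => -c p) n m u = -expSum r c n m u := by
  simp [expSum]

lemma expSum_eq_zero_of_coeff {c : ℕ → ℝ} (hc : ∀ p ≤ n, c p = 0) (m : ℕ) (u : ℝ) :
    expSum r c n m u = 0 :=
  Finset.sum_eq_zero fun j hj => by
    rw [hc j (by simpa [Nat.lt_succ_iff] using hj)]; ring

lemma expSum_reflect (c : ℕ → ℝ) (m : ℕ) (u : ℝ) :
    expSum (fun j => -r j) c n m (-u) = (-1) ^ m * expSum r c n m u := by
  simp only [expSum, Finset.mul_sum]
  refine Finset.sum_congr rfl fun j _ => ?_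
  rw [neg_pow (r j), neg_mul_neg]
  ring

lemma expSum_mul_exponent (c : ℕ → ℝ) (m : ℕ) (u : ℝ) :
    expSum r (fun p => c p * r p) n m u = expSum r c n (m + 1) u :=
  Finset.sum_congr rfl fun _ _ => by ring

lemma expSum_sub_exponent_eq_zero {c : ℕ → ℝ} {m : ℕ} {x : ℝ} (ρ : ℝ)
    (h : ∀ l ≤ m, expSum r c n l x = 0) : expSum (fun j => r j - ρ) c n m x = 0 := by
  have key : expSum (fun j => r j - ρ) c n m x =
      ∑ l ∈ Finset.range (m + 1),
        Real.exp (-ρ * x) * (-ρ) ^ (m - l) * (m.choose l) * expSum r c n l x := by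
    simp only [expSum, Finset.mul_sum]
    rw [Finset.sum_comm]
    refine Finset.sum_congr rfl fun j _ => ?_
    rw [sub_eq_add_neg, add_pow, add_mul, Real.exp_add, Finset.mul_sum, Finset.sum_mul]
    exact Finset.sum_congr rfl fun _ _ => by ring
  rw [key]
  exact Finset.sum_eq_zero fun l hl => by
    rw [h l (by simpa [Nat.lt_succ_iff] using hl), mul_zero]

/-- An exponential sum with `n + 1` distinct exponents and `n + 1` real zeros, counted with
multiplicity, is trivial. The zeros are listed in increasing order, with repetitions. -/
theorem coeff_eq_zero_of_zeros (n : ℕ) : ∀ (r c x : ℕ → ℝ), (∀ i < n, r i < r (i + 1)) →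
    Monotone x → (∀ i m, i + m ≤ n → x i = x (i + m) → expSum r c n m (x i) = 0) →
    ∀ j ≤ n, c j = 0 := by
  induction n with
  | zero =>
    intro r c x _ _ h j hj
    obtain rfl : j = 0 := by omega
    simpa [expSum, (Real.exp_pos _).ne'] using h 0 0 le_rfl rfl
  | succ n ih =>
    intro r c x hr hx h
    have hs : ∀ i m, i + m ≤ n + 1 → x i = x (i + m) →
        expSum (fun j => r j - r 0) c (n + 1) m (x i) = 0 := fun i m him hxi =>
      expSum_sub_exponent_eq_zero _ fun l hl => h i l (by omega)
        (le_antisymm (hx (by omega)) (hxi ▸ hx (by omega)))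
    have hy : ∀ i, ∃ y, x i ≤ y ∧ y ≤ x (i + 1) ∧
        (i ≤ n → x i < x (i + 1) → x i < y ∧ y < x (i + 1)) ∧
        (i ≤ n → expSum (fun j => r j - r 0) c (n + 1) 1 y = 0) := by
      intro i
      by_cases hi : i ≤ n
      · rcases (hx (Nat.le_succ i)).lt_or_eq with hlt | heq
        · obtain ⟨y, hy, hy0⟩ := exists_hasDerivAt_eq_zero hlt
            (continuous_expSum (r := fun j => r j - r 0) (n := n + 1) c 0).continuousOn
            ((hs i 0 (by omega) rfl).trans (hs (i + 1) 0 (by omega) rfl).symm)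
            fun u _ => hasDerivAt_expSum c 0 u
          exact ⟨y, hy.1.le, hy.2.le, fun _ _ => hy, fun _ => hy0⟩
        · exact ⟨x i, le_rfl, heq.le, fun _ hlt => absurd heq hlt.ne,
            fun _ => hs i 1 (by omega) heq⟩
      · exact ⟨x i, le_rfl, hx (Nat.le_succ i), fun h => absurd h hi, fun h => absurd h hi⟩
    choose y hy1 hy2 hy3 hy4 using hy
    have hD : ∀ m u, expSum (fun j => r (j + 1) - r 0) (fun j => c (j + 1) * (r (j + 1) - r 0))
        n m u = expSum (fun j => r j - r 0) c (n + 1) (m + 1) u := by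
      intro m u
      simp only [expSum]
      rw [Finset.sum_range_succ' _ (n + 1)]
      simp only [sub_self, zero_pow (Nat.succ_ne_zero m), mul_zero, zero_mul, add_zero]
      exact Finset.sum_congr rfl fun _ _ => by ring
    have hymono : Monotone y := monotone_nat_of_le_succ fun i => (hy2 i).trans (hy1 (i + 1))
    have hc : ∀ j ≤ n, c (j + 1) * (r (j + 1) - r 0) = 0 := by
      refine ih (fun j => r (j + 1) - r 0) (fun j => c (j + 1) * (r (j + 1) - r 0)) y
        (fun i hi => by simpa using hr (i + 1) (by omega)) hymono ?_
      intro i m him hyi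
      rw [hD]
      rcases Nat.eq_zero_or_pos m with rfl | hm
      · exact hy4 i him
      · have e1 : y i = x (i + 1) := le_antisymm (hy2 i)
          (hyi ▸ (hx (by omega : i + 1 ≤ i + m)).trans (hy1 (i + m)))
        have e2 : x (i + 1) = x i := by
          by_contra hne
          exact ((hy3 i (by omega) (lt_of_le_of_ne (hx (by omega)) (Ne.symm hne))).2).ne e1
        have e3 : y (i + m) = x (i + m) := le_antisymm
          (hyi ▸ e1 ▸ hx (by omega : i + 1 ≤ i + m)) (hy1 _)
        have e4 : x (i + m) = x (i + m + 1) := by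
          by_contra hne
          exact ((hy3 (i + m) (by omega) (lt_of_le_of_ne (hx (by omega)) hne)).1).ne' e3
        have e5 : x i = x (i + (m + 1)) := by
          rw [← add_assoc, ← e4, ← e3, ← hyi, e1, e2]
        have := hs i (m + 1) (by omega) e5
        rwa [e1, e2]
    have hc1 : ∀ j ≤ n, c (j + 1) = 0 := fun j hj =>
      (mul_eq_zero.1 (hc j hj)).resolve_right
        (sub_ne_zero.2 (lt_of_step_lt hr (Nat.succ_pos j) (by omega)).ne')
    have hc0 : c 0 = 0 := by
      have h0 := h 0 0 (by omega) rfl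
      simp only [expSum] at h0
      rw [Finset.sum_range_succ', Finset.sum_eq_zero fun j hj => by
        rw [hc1 j (by simpa [Nat.lt_succ_iff] using hj)]; ring] at h0
      simpa [(Real.exp_pos _).ne'] using h0
    rintro (_ | j) hj
    · exact hc0
    · exact hc1 j (by omega)

lemma coeff_eq_zero_of_zeros_of_support {c x : ℕ → ℝ} (hr : ∀ i < n, r i < r (i + 1))
    (hx : Monotone x) {j N : ℕ} (hj : j + N = n) (hc : ∀ i < j, c i = 0)
    (h : ∀ i m, i + m ≤ N → x i = x (i + m) → expSum r c n m (x i) = 0) :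
    ∀ p ≤ n, c p = 0 := by
  subst hj
  have hE : ∀ m u, expSum (fun i => r (j + i)) (fun i => c (j + i)) N m u =
      expSum r c (j + N) m u := by
    intro m u
    simp only [expSum]
    rw [add_assoc j N 1, Finset.sum_range_add _ j (N + 1), Finset.sum_eq_zero (s := Finset.range j)
      fun i hi => by rw [hc i (Finset.mem_range.1 hi)]; ring, zero_add]
  have h0 := coeff_eq_zero_of_zeros N (fun i => r (j + i)) (fun i => c (j + i)) x
    (fun i hi => hr (j + i) (by omega)) hx fun i m him hxi => by rw [hE]; exact h i m him hxi
  intro p hp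
  rcases lt_or_ge p j with hlt | hge
  · exact hc p hlt
  · simpa [Nat.add_sub_cancel' hge] using h0 (p - j) (by omega)

variable {α β : ℝ}

lemma coeff_eq_zero_of_two_zeros {c : ℕ → ℝ} (hr : ∀ i < n, r i < r (i + 1)) (hαβ : α < β)
    {j k l : ℕ} (hj : j ≤ n) (hjkl : j + k + l = n + 1) (hc : ∀ i < j, c i = 0)
    (hα : ∀ m < k, expSum r c n m α = 0) (hβ : ∀ m < l, expSum r c n m β = 0) :
    ∀ p ≤ n, c p = 0 := by
  refine coeff_eq_zero_of_zeros_of_support (x := fun i => if i < k then α else β) hr ?_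
    (N := n - j) (by omega) hc ?_
  · intro i i' hii'
    dsimp only
    split_ifs <;> first | omega | linarith
  · intro i m him hxi
    split_ifs at hxi ⊢
    · exact hα m (by omega)
    · exact absurd hxi hαβ.ne
    · omega
    · exact hβ m (by omega)

lemma coeff_eq_zero_of_three_zeros {c : ℕ → ℝ} (hr : ∀ i < n, r i < r (i + 1)) {γ : ℝ}
    (hαγ : α < γ) (hγβ : γ < β) {j k l : ℕ} (hjkl : j + k + l = n)
    (hc : ∀ i < j, c i = 0) (hα : ∀ m < k, expSum r c n m α = 0)
    (hγ : expSum r c n 0 γ = 0) (hβ : ∀ m < l, expSum r c n m β = 0) :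
    ∀ p ≤ n, c p = 0 := by
  refine coeff_eq_zero_of_zeros_of_support
    (x := fun i => if i < k then α else if i = k then γ else β) hr ?_
    (N := n - j) (by omega) hc ?_
  · intro i i' hii'
    dsimp only
    split_ifs <;> first | omega | linarith
  · intro i m him hxi
    split_ifs at hxi ⊢ <;> first | omega | linarith | skip
    · exact hα m (by omega)
    · obtain rfl : m = 0 := by omega
      exact hγ
    · exact hβ m (by omega)

lemma coeff_eq_zero_of_eqOn_zero {c : ℕ → ℝ} (hr : ∀ i < n, r i < r (i + 1)) (hαβ : α < β)
    (h : ∀ u ∈ Set.Icc α β, expSum r c n 0 u = 0) : ∀ p ≤ n, c p = 0 := by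
  have hx : StrictMono fun i : ℕ => α + (β - α) / (n + 1) * i := by
    intro i i' hii'
    have : (i : ℝ) < i' := by exact_mod_cast hii'
    have : 0 < (β - α) / (n + 1) := div_pos (sub_pos.2 hαβ) (by positivity)
    dsimp only
    gcongr
  refine coeff_eq_zero_of_zeros n r c _ hr hx.monotone fun i m him hxi => ?_
  obtain rfl : m = 0 := by
    have := hx.injective hxi
    omega
  have hi : (i : ℝ) ≤ n + 1 := by exact_mod_cast (by omega : i ≤ n + 1)
  have hd := sub_pos.2 hαβ
  refine h _ ⟨le_add_of_nonneg_right (by positivity), ?_⟩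
  have : (β - α) / (n + 1) * i ≤ (β - α) / (n + 1) * (n + 1) := by gcongr
  rw [div_mul_cancel₀ _ (by positivity)] at this
  linarith

lemma expSum_pos_right (c : ℕ → ℝ) (k : ℕ) : ∀ m, (∀ l < k, expSum r c n (m + l) α = 0) →
    0 < expSum r c n (m + k) α → ∃ δ > α, ∀ u ∈ Set.Ioo α δ, 0 < expSum r c n m u := by
  induction k with
  | zero =>
    intro m _ h
    have := (continuous_expSum (r := r) (n := n) c m).continuousAt.eventually (lt_mem_nhds h)
    obtain ⟨δ, hδ, hs⟩ := mem_nhdsGT_iff_exists_Ioo_subset.1 (mem_nhdsWithin_of_mem_nhds this)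
    exact ⟨δ, hδ, fun u hu => hs hu⟩
  | succ k ih =>
    intro m hv h
    obtain ⟨δ, hδ, hs⟩ := ih (m + 1)
      (fun l hl => by rw [add_assoc, add_comm 1]; exact hv (l + 1) (by omega))
      (by rwa [add_assoc, add_comm 1])
    refine ⟨δ, hδ, fun u hu => ?_⟩
    obtain ⟨ξ, hξ, he⟩ := exists_hasDerivAt_eq_slope (expSum r c n m) _ hu.1
      (continuous_expSum c m).continuousOn fun v _ => hasDerivAt_expSum c m v
    have hp := hs ξ ⟨hξ.1, hξ.2.trans hu.2⟩
    have h0 : expSum r c n m α = 0 := hv 0 (Nat.succ_pos k)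
    rw [he, h0, sub_zero] at hp
    exact (div_pos_iff_of_pos_right (sub_pos.2 hu.1)).1 hp

lemma expSum_pos_left (c : ℕ → ℝ) (l : ℕ) (hv : ∀ m < l, expSum r c n m β = 0)
    (h : 0 < (-1) ^ l * expSum r c n l β) :
    ∃ δ < β, ∀ u ∈ Set.Ioo δ β, 0 < expSum r c n 0 u := by
  obtain ⟨δ, hδ, hs⟩ := expSum_pos_right (r := fun j => -r j) (n := n) (α := -β) c l 0
    (fun m hm => by rw [zero_add, expSum_reflect, hv m hm, mul_zero])
    (by rwa [zero_add, expSum_reflect])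
  refine ⟨-δ, by linarith, fun u hu => ?_⟩
  simpa [expSum_reflect] using hs (-u) ⟨by linarith [hu.2], by linarith [hu.1]⟩

/-- The signs at `α` and at `β` of an exponential sum all of whose zeros are at `α` and `β`. -/
lemma endpoint_sign {c : ℕ → ℝ} (hr : ∀ i < n, r i < r (i + 1)) (hαβ : α < β)
    {j k l : ℕ} (hjkl : j + k + l = n) (hc : ∀ i < j, c i = 0)
    (hα : ∀ m < k, expSum r c n m α = 0) (hβ : ∀ m < l, expSum r c n m β = 0)
    (hpos : 0 < expSum r c n k α) : 0 < (-1) ^ l * expSum r c n l β := by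
  have contra : ¬ ∀ p ≤ n, c p = 0 := fun h => hpos.ne' (expSum_eq_zero_of_coeff h k α)
  by_contra! hle
  rcases hle.lt_or_eq with hlt | heq
  · obtain ⟨δ, hδ, h1⟩ := expSum_pos_right c k 0 (by simpa using hα) (by simpa using hpos)
    obtain ⟨ε, hε, h2⟩ := expSum_pos_left (fun p => -c p) l
      (fun m hm => by rw [expSum_neg, hβ m hm, neg_zero])
      (by rw [expSum_neg]; linarith)
    obtain ⟨u, hu1, hu2⟩ := exists_between (lt_min hδ hαβ)
    obtain ⟨v, hv1, hv2⟩ := exists_between (max_lt hε (hu2.trans_le (min_le_right _ _)))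
    have hu := h1 u ⟨hu1, hu2.trans_le (min_le_left _ _)⟩
    have hv := h2 v ⟨(le_max_left _ _).trans_lt hv1, hv2⟩
    rw [expSum_neg] at hv
    have huv : u < v := (le_max_right _ _).trans_lt hv1
    obtain ⟨γ, hγ, hγ0⟩ := intermediate_value_Ioo' huv.le
      (continuous_expSum (r := r) (n := n) c 0).continuousOn ⟨neg_pos.1 hv, hu⟩
    exact contra (coeff_eq_zero_of_three_zeros hr (hu1.trans hγ.1) (hγ.2.trans hv2) hjkl hc hα
      hγ0 hβ)
  · refine contra (coeff_eq_zero_of_two_zeros hr hαβ (l := l + 1) (by omega) (by omega) hc hα ?_)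
    intro m hm
    rcases Nat.lt_succ_iff_lt_or_eq.1 hm with h | rfl
    · exact hβ m h
    · simpa using heq

lemma endpoint_sign_symm {c : ℕ → ℝ} (hr : ∀ i < n, r i < r (i + 1)) (hαβ : α < β)
    {j k l : ℕ} (hjkl : j + k + l = n) (hc : ∀ i < j, c i = 0)
    (hα : ∀ m < k, expSum r c n m α = 0) (hβ : ∀ m < l, expSum r c n m β = 0)
    (hpos : 0 < (-1) ^ l * expSum r c n l β) : 0 < expSum r c n k α := by
  by_contra! hle
  rcases hle.lt_or_eq with hlt | heq
  · have := endpoint_sign (c := fun p => -c p) hr hαβ hjkl (fun i hi => by rw [hc i hi, neg_zero])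
      (fun m hm => by rw [expSum_neg, hα m hm, neg_zero])
      (fun m hm => by rw [expSum_neg, hβ m hm, neg_zero]) (by rw [expSum_neg]; linarith)
    rw [expSum_neg] at this
    linarith
  · have h0 := coeff_eq_zero_of_two_zeros hr hαβ (k := k + 1) (by omega) (by omega) hc
      (fun m hm => (Nat.lt_succ_iff_lt_or_eq.1 hm).elim (hα m) fun h => h ▸ heq) hβ
    rw [expSum_eq_zero_of_coeff h0, mul_zero] at hpos
    exact hpos.false

lemma exists_expSum_with_zeros (hr : ∀ i < n, r i < r (i + 1)) (hαβ : α < β)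
    {j k l : ℕ} (hjkl : j + k + l = n) :
    ∃ c : ℕ → ℝ, (∀ i < j, c i = 0) ∧ (∀ m < k, expSum r c n m α = 0) ∧
      (∀ m < l, expSum r c n m β = 0) ∧ 0 < expSum r c n k α := by
  let e : (Fin (n + 1) → ℝ) →ₗ[ℝ] (ℕ → ℝ) :=
    LinearMap.pi fun p => if h : p < n + 1 then LinearMap.proj ⟨p, h⟩ else 0
  let E : ℕ → ℝ → (ℕ → ℝ) →ₗ[ℝ] ℝ := fun m u =>
    ∑ p ∈ Finset.range (n + 1), (r p ^ m * Real.exp (r p * u)) • LinearMap.proj p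
  have hE : ∀ m u c, E m u c = expSum r c n m u := by
    intro m u c
    simp only [E, expSum, LinearMap.sum_apply, LinearMap.smul_apply, LinearMap.proj_apply,
      smul_eq_mul]
    exact Finset.sum_congr rfl fun _ _ => by ring
  let T : (Fin (n + 1) → ℝ) →ₗ[ℝ] (Fin j ⊕ Fin k ⊕ Fin l → ℝ) :=
    LinearMap.pi (Sum.elim (fun i => LinearMap.proj (i : ℕ) ∘ₗ e)
      (Sum.elim (fun m => E m α ∘ₗ e) fun m => E m β ∘ₗ e))
  have hT : LinearMap.ker T ≠ ⊥ := LinearMap.ker_ne_bot_of_finrank_lt (by simp; omega)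
  obtain ⟨v, hv, hv0⟩ := (Submodule.ne_bot_iff _).1 hT
  have hTv : ∀ s, T v s = 0 := fun s => congrFun (LinearMap.mem_ker.1 hv) s
  have hc : ∀ i < j, e v i = 0 := fun i hi => hTv (Sum.inl ⟨i, hi⟩)
  have hα : ∀ m < k, expSum r (e v) n m α = 0 := fun m hm =>
    (hE m α (e v)).symm.trans (hTv (Sum.inr (Sum.inl ⟨m, hm⟩)))
  have hβ : ∀ m < l, expSum r (e v) n m β = 0 := fun m hm =>
    (hE m β (e v)).symm.trans (hTv (Sum.inr (Sum.inr ⟨m, hm⟩)))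
  rcases lt_trichotomy (expSum r (e v) n k α) 0 with h | h | h
  · exact ⟨fun p => -e v p, fun i hi => neg_eq_zero.2 (hc i hi),
      fun m hm => by rw [expSum_neg, hα m hm, neg_zero],
      fun m hm => by rw [expSum_neg, hβ m hm, neg_zero], by rw [expSum_neg]; linarith⟩
  · have h0 := coeff_eq_zero_of_two_zeros hr hαβ (k := k + 1) (by omega) (by omega) hc
      (fun m hm => (Nat.lt_succ_iff_lt_or_eq.1 hm).elim (hα m) fun h' => h' ▸ h) hβ
    refine absurd (funext fun p => ?_) hv0
    have h1 : e v p = v p := by simp only [e, LinearMap.pi_apply, dif_pos p.2, LinearMap.proj_apply]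
    exact h1.symm.trans (h0 p (by omega))
  · exact ⟨e v, hc, hα, hβ, h⟩

/-- An exponential sum with exponents `r_j, …, r_n`, with all its zeros at `α` and `β` and
positive in between, is a nonnegative combination of Bernstein-type functions on `[α, β]`. -/
lemma exists_nonneg_combination (hr : ∀ i < n, r i < r (i + 1)) (hαβ : α < β) {b : ℕ → ℕ → ℝ}
    (hbα : ∀ k ≤ n, ∀ m < k, expSum r (b k) n m α = 0)
    (hbβ : ∀ k ≤ n, ∀ m < n - k, expSum r (b k) n m β = 0)
    (hb : ∀ k ≤ n, 0 < expSum r (b k) n k α) (j : ℕ) :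
    ∀ k l, j + k + l = n → ∀ c : ℕ → ℝ, (∀ i < j, c i = 0) →
      (∀ m < k, expSum r c n m α = 0) → (∀ m < l, expSum r c n m β = 0) →
      0 < expSum r c n k α →
      ∃ s : ℕ → ℝ, (∀ i, 0 ≤ s i) ∧
        ∀ p ≤ n, c p = ∑ i ∈ Finset.range (n + 1), s i * b i p := by
  induction j with
  | zero =>
    intro k l hkl c hc hα hβ hpos
    have hk : k ≤ n := by omega
    set x := expSum r c n k α / expSum r (b k) n k α with hx
    have h0 := coeff_eq_zero_of_two_zeros (c := fun p => c p - x * b k p) hr hαβ (j := 0)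
      (k := k + 1) (l := l) (by omega) (by omega) (by simp)
      (fun m hm => by
        rw [expSum_sub_mul]
        rcases Nat.lt_succ_iff_lt_or_eq.1 hm with h | rfl
        · rw [hα m h, hbα k hk m h]; ring
        · rw [hx, div_mul_cancel₀ _ (hb m hk).ne', sub_self])
      (fun m hm => by rw [expSum_sub_mul, hβ m hm, hbβ k hk m (by omega)]; ring)
    refine ⟨fun i => if i = k then x else 0, fun i => ?_, fun p hp => ?_⟩
    · dsimp only
      split_ifs
      · exact (div_pos hpos (hb k hk)).le
      · exact le_rfl
    · simp only [ite_mul, zero_mul, Finset.sum_ite_eq', Finset.mem_range, Nat.lt_succ_iff, hk,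
        if_true]
      exact sub_eq_zero.1 (h0 p hp)
  | succ j ih =>
    intro k l hkl c hc hα hβ hpos
    obtain ⟨q, hqc, hqα, hqβ, hq⟩ := exists_expSum_with_zeros (r := r) (n := n) hr hαβ
      (j := j) (k := k) (l := l + 1) (by omega)
    obtain ⟨q', hqc', hqα', hqβ', hq'⟩ := exists_expSum_with_zeros (r := r) (n := n) hr hαβ
      (j := j) (k := k + 1) (l := l) (by omega)
    obtain ⟨s, hs, hs1⟩ := ih k (l + 1) (by omega) q hqc hqα hqβ hq
    obtain ⟨s', hs', hs1'⟩ := ih (k + 1) l (by omega) q' hqc' hqα' hqβ' hq'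
    have hcl := endpoint_sign hr hαβ hkl hc hα hβ hpos
    have hql := endpoint_sign hr hαβ (by omega) hqc' hqα' hqβ' hq'
    set x := expSum r c n k α / expSum r q n k α with hx
    set y := expSum r c n l β / expSum r q' n l β with hy
    have hx0 : 0 < x := div_pos hpos hq
    have hy0 : 0 < y := by
      have := div_pos hcl hql
      rwa [mul_div_mul_left _ _ (pow_ne_zero l (by norm_num))] at this
    have hq0 : expSum r q' n l β ≠ 0 := right_ne_zero_of_mul hql.ne'
    have h0 := coeff_eq_zero_of_two_zeros (c := fun p => (c p - x * q p) - y * q' p) hr hαβ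
      (j := j) (k := k + 1) (l := l + 1) (by omega) (by omega)
      (fun i hi => by rw [hc i (by omega), hqc i hi, hqc' i hi]; ring)
      (fun m hm => by
        rw [expSum_sub_mul (fun p => c p - x * q p), expSum_sub_mul, hqα' m hm]
        rcases Nat.lt_succ_iff_lt_or_eq.1 hm with h | rfl
        · rw [hα m h, hqα m h]; ring
        · rw [hx, div_mul_cancel₀ _ hq.ne']; ring)
      (fun m hm => by
        rw [expSum_sub_mul (fun p => c p - x * q p), expSum_sub_mul, hqβ m hm]
        rcases Nat.lt_succ_iff_lt_or_eq.1 hm with h | rfl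
        · rw [hβ m h, hqβ' m h]; ring
        · rw [hy, div_mul_cancel₀ _ hq0]; ring)
    refine ⟨fun i => x * s i + y * s' i, fun i => add_nonneg (mul_nonneg hx0.le (hs i))
      (mul_nonneg hy0.le (hs' i)), fun p hp => ?_⟩
    have e : c p = x * q p + y * q' p := by linarith [h0 p hp]
    rw [e, hs1 p hp, hs1' p hp, Finset.mul_sum, Finset.mul_sum, ← Finset.sum_add_distrib]
    exact Finset.sum_congr rfl fun _ _ => by ring

/-- Functions of Bernstein type that sum to `1` are positive to the right of `α`. -/
lemma bernstein_pos (hr : ∀ i < n, r i < r (i + 1)) (hr0 : r 0 = 0) (hαβ : α < β)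
    {b : ℕ → ℕ → ℝ} (hbα : ∀ k ≤ n, ∀ m < k, expSum r (b k) n m α = 0)
    (hbβ : ∀ k ≤ n, ∀ m < n - k, expSum r (b k) n m β = 0)
    (hb1 : ∀ p ≤ n, ∑ k ∈ Finset.range (n + 1), b k p = if p = 0 then 1 else 0) :
    ∀ k ≤ n, 0 < expSum r (b k) n k α := by
  have hsum : ∀ m u, ∑ k ∈ Finset.range (n + 1), expSum r (b k) n m u =
      if m = 0 then 1 else 0 := by
    intro m u
    have h := expSum_sum_mul (r := r) (n := n) (Finset.range (n + 1)) (fun _ => 1) b m u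
    simp only [one_mul] at h
    rw [← h, expSum, Finset.sum_range_succ', Finset.sum_eq_zero fun j hj => by
      rw [hb1 (j + 1) (by simpa using hj)]; simp, hb1 0 (Nat.zero_le n), hr0]
    simp [zero_pow_eq]
  intro k hk
  rcases Nat.eq_zero_or_pos k with rfl | hk0
  · have h := hsum 0 α
    rw [Finset.sum_range_succ', Finset.sum_eq_zero fun j hj =>
      hbα (j + 1) (by simpa using hj) 0 (Nat.succ_pos j)] at h
    simp at h
    rw [h]; exact one_pos
  set V : ℕ → ℝ := fun p => ∑ i ∈ Finset.Ico k (n + 1), 1 * b i p with hV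
  have hVs : ∀ m u, expSum r V n m u = ∑ i ∈ Finset.Ico k (n + 1), expSum r (b i) n m u :=
    fun m u => by rw [hV, expSum_sum_mul]; simp
  have hVα : ∀ m < k, expSum r V n m α = 0 := fun m hm => by
    rw [hVs]
    exact Finset.sum_eq_zero fun i hi => by
      rw [Finset.mem_Ico] at hi
      exact hbα i (by omega) m (by omega)
  have hVk : expSum r V n k α = expSum r (b k) n k α := by
    rw [hVs, Finset.sum_eq_sum_Ico_succ_bot (by omega), Finset.sum_eq_zero, add_zero]
    intro i hi
    rw [Finset.mem_Ico] at hi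
    exact hbα i (by omega) k (by omega)
  have hVβ : ∀ m < n - k + 1, expSum r V n m β = if m = 0 then 1 else 0 := fun m hm => by
    rw [hVs, ← hsum m β, ← Finset.sum_range_add_sum_Ico _ (by omega : k ≤ n + 1),
      Finset.sum_eq_zero (s := Finset.range k), zero_add]
    intro i hi
    rw [Finset.mem_range] at hi
    exact hbβ i (by omega) m (by omega)
  have hW0 : ∀ i < 1, V i * r i = 0 := fun i hi => by
    obtain rfl : i = 0 := by omega
    rw [hr0, mul_zero]
  have hWα : ∀ m < k - 1, expSum r (fun p => V p * r p) n m α = 0 := fun m hm => by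
    rw [expSum_mul_exponent, hVα _ (by omega)]
  have hWβ : ∀ m < n - k, expSum r (fun p => V p * r p) n m β = 0 := fun m hm => by
    rw [expSum_mul_exponent, hVβ _ (by omega), if_neg (Nat.succ_ne_zero m)]
  have contra : ¬ ∀ p ≤ n, V p * r p = 0 := by
    intro h
    have h1 : expSum r V n 0 β = 1 := by simpa using hVβ 0 (Nat.succ_pos _)
    have h2 : expSum r V n 0 β = expSum r V n 0 α := by
      refine Finset.sum_congr rfl fun p hp => ?_
      rcases mul_eq_zero.1 (h p (by simpa [Nat.lt_succ_iff] using hp)) with h' | h' <;> simp [h']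
    rw [hVα 0 hk0] at h2
    linarith
  rw [← hVk]
  by_contra! hle
  rcases hle.lt_or_eq with hlt | heq
  · obtain ⟨δ, hδ, h1⟩ := expSum_pos_right (r := r) (n := n) (α := α) (fun p => -V p) k 0
      (fun m hm => by rw [zero_add, expSum_neg, hVα m hm, neg_zero])
      (by rw [zero_add, expSum_neg]; linarith)
    obtain ⟨u, hu1, hu2⟩ := exists_between (lt_min hδ hαβ)
    have hu := h1 u ⟨hu1, hu2.trans_le (min_le_left _ _)⟩
    have huβ := hu2.trans_le (min_le_right _ _)
    rw [expSum_neg] at hu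
    obtain ⟨γ, hγ, hγ0⟩ := intermediate_value_Ioo huβ.le
      (continuous_expSum (r := r) (n := n) V 0).continuousOn
      ⟨neg_pos.1 hu, by rw [hVβ 0 (Nat.succ_pos _)]; simp⟩
    obtain ⟨ξ, hξ, hξ0⟩ := exists_hasDerivAt_eq_zero (hu1.trans hγ.1)
      (continuous_expSum (r := r) (n := n) V 0).continuousOn
      ((hVα 0 hk0).trans hγ0.symm) fun u _ => hasDerivAt_expSum V 0 u
    exact contra (coeff_eq_zero_of_three_zeros hr hξ.1 (hξ.2.trans hγ.2) (j := 1) (k := k - 1)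
      (l := n - k) (by omega) hW0 hWα (by rw [expSum_mul_exponent]; exact hξ0) hWβ)
  · refine contra (coeff_eq_zero_of_two_zeros hr hαβ (j := 1) (k := k) (l := n - k) (by omega)
      (by omega) hW0 (fun m hm => ?_) hWβ)
    rw [expSum_mul_exponent]
    rcases (Nat.succ_le_of_lt hm).lt_or_eq with h | h
    · exact hVα _ h
    · rwa [← h] at heq

lemma bernstein_independent {b : ℕ → ℕ → ℝ}
    (hbα : ∀ k ≤ n, ∀ m < k, expSum r (b k) n m α = 0)
    (hb : ∀ k ≤ n, 0 < expSum r (b k) n k α) {x : ℕ → ℝ}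
    (hx : ∀ p ≤ n, ∑ k ∈ Finset.range (n + 1), x k * b k p = 0) : ∀ k ≤ n, x k = 0 := by
  intro k
  induction k using Nat.strong_induction_on with
  | _ k ih =>
    intro hk
    have h := expSum_sum_mul (r := r) (n := n) (Finset.range (n + 1)) x b k α
    rw [expSum_eq_zero_of_coeff hx, Finset.sum_eq_single k] at h
    · exact (mul_eq_zero.1 h.symm).resolve_right (hb k hk).ne'
    · intro i hi hik
      rw [Finset.mem_range] at hi
      rcases lt_or_gt_of_ne hik with h' | h'
      · rw [ih i h' (by omega), zero_mul]
      · rw [hbα i (by omega) k h', mul_zero]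
    · exact fun h' => absurd (Finset.mem_range.2 (by omega)) h'

end ExpSum

section DividedDifference

/-- The divided difference of `g` at the consecutive points `r k, …, r (k + N)`. -/
noncomputable def divDiffFrom (r : ℕ → ℝ) (g : ℝ → ℝ) (N k : ℕ) : ℝ :=
  divDiff g N fun i => r (k + i.val)

variable {r : ℕ → ℝ} {n : ℕ}

@[simp]
lemma divDiffFrom_zero (g : ℝ → ℝ) (k : ℕ) : divDiffFrom r g 0 k = g (r k) := by
  simp [divDiffFrom, divDiff]

lemma divDiffFrom_succ (g : ℝ → ℝ) (N k : ℕ) :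
    divDiffFrom r g (N + 1) k =
      (divDiffFrom r g N (k + 1) - divDiffFrom r g N k) / (r (k + N + 1) - r k) := by
  simp only [divDiffFrom, divDiff, Fin.val_succ, Fin.val_castSucc, Fin.val_last, Fin.val_zero,
    add_zero]
  simp only [add_assoc, add_comm 1]

lemma divDiffFrom_add (g h : ℝ → ℝ) (N : ℕ) :
    ∀ k, divDiffFrom r (fun x => g x + h x) N k = divDiffFrom r g N k + divDiffFrom r h N k := by
  induction N with
  | zero => simp
  | succ N ih => intro k; simp only [divDiffFrom_succ, ih]; ring

lemma divDiffFrom_one (N k : ℕ) : divDiffFrom r (fun _ => 1) N k = if N = 0 then 1 else 0 := by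
  induction N generalizing k with
  | zero => simp
  | succ N ih => rw [divDiffFrom_succ, ih, ih]; simp

lemma divDiffFrom_id_mul (hr : ∀ i < n, r i < r (i + 1)) (g : ℝ → ℝ) (N : ℕ) :
    ∀ k, k + N + 1 ≤ n → divDiffFrom r (fun x => x * g x) (N + 1) k =
      r k * divDiffFrom r g (N + 1) k + divDiffFrom r g N (k + 1) := by
  induction N with
  | zero =>
    intro k hk
    have h := sub_ne_zero.2 (lt_of_step_lt hr (by omega : k < k + 0 + 1) hk).ne'
    rw [divDiffFrom_succ, divDiffFrom_succ]
    simp only [divDiffFrom_zero]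
    field_simp
    ring_nf
  | succ N ih =>
    intro k hk
    have h := sub_ne_zero.2 (lt_of_step_lt hr (by omega : k < k + (N + 1) + 1) hk).ne'
    have h' := sub_ne_zero.2 (lt_of_step_lt hr (by omega : k + 1 < k + 1 + N + 1) (by omega)).ne'
    have e := divDiffFrom_succ (r := r) g N (k + 1)
    rw [eq_div_iff h', show k + 1 + N + 1 = k + (N + 1) + 1 by omega] at e
    rw [divDiffFrom_succ, divDiffFrom_succ g (N + 1), ih k (by omega), ih (k + 1) (by omega)]
    field_simp
    linarith

lemma divDiffFrom_pow (hr : ∀ i < n, r i < r (i + 1)) (m : ℕ) :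
    ∀ N k, m ≤ N → k + N ≤ n →
      divDiffFrom r (fun x => x ^ m) N k = if m = N then 1 else 0 := by
  induction m with
  | zero =>
    intro N k _ _
    simp only [pow_zero, divDiffFrom_one, eq_comm]
  | succ m ih =>
    rintro (_ | N) k hN hk
    · omega
    · simp only [pow_succ']
      rw [divDiffFrom_id_mul hr _ N k (by omega), ih (N + 1) k (by omega) hk,
        ih N (k + 1) (by omega) (by omega), if_neg (by omega)]
      simp

lemma exists_divDiffFrom_weights (N : ℕ) : ∀ k, k + N ≤ n → ∃ d : ℕ → ℝ, (∀ i < k, d i = 0) ∧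
    ∀ g : ℝ → ℝ, divDiffFrom r g N k = ∑ i ∈ Finset.range (n + 1), d i * g (r i) := by
  induction N with
  | zero =>
    intro k hk
    refine ⟨fun i => if i = k then 1 else 0, fun i hi => if_neg hi.ne, fun g => ?_⟩
    simp only [divDiffFrom_zero, ite_mul, one_mul, zero_mul, Finset.sum_ite_eq',
      Finset.mem_range]
    rw [if_pos (by omega)]
  | succ N ih =>
    intro k hk
    obtain ⟨d, hd, hd'⟩ := ih k (by omega)
    obtain ⟨e, he, he'⟩ := ih (k + 1) (by omega)
    refine ⟨fun i => (e i - d i) / (r (k + N + 1) - r k), fun i hi => ?_, fun g => ?_⟩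
    · simp only [hd i hi, he i (by omega), sub_self, zero_div]
    · rw [divDiffFrom_succ, hd', he', ← Finset.sum_sub_distrib, Finset.sum_div]
      exact Finset.sum_congr rfl fun _ _ => by ring

lemma gelfond_eq_divDiffFrom {k : ℕ} (t : ℝ) :
    gelfond r n k t = (-1) ^ (n - k) * (∏ j ∈ Finset.Icc (k + 1) n, r j) *
      divDiffFrom r (fun x => t ^ x) (n - k) k := by
  rw [gelfond]
  split_ifs with h
  · subst h
    simp
  · rfl

/-- The Gelfond–Bernstein functions form a partition of unity. -/
lemma sum_gelfond (hr : ∀ i < n, r i < r (i + 1)) (hr0 : r 0 = 0) (t : ℝ) :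
    ∑ k ∈ Finset.range (n + 1), gelfond r n k t = 1 := by
  set C : ℕ → ℝ := fun k => (-1) ^ (n - k) * ∏ j ∈ Finset.Icc (k + 1) n, r j with hC
  have hCn : C n = 1 := by simp [hC]
  have hCs : ∀ k < n, C k = -(r (k + 1) * C (k + 1)) := by
    intro k hk
    simp only [hC]
    rw [← Finset.insert_Icc_add_one_left_eq_Icc (by omega : k + 1 ≤ n),
      Finset.prod_insert (by simp), show n - k = n - (k + 1) + 1 by omega, pow_succ]
    ring
  set g : ℝ → ℝ := fun x => (t ^ x - 1) / x with hg
  have htg : (fun x : ℝ => t ^ x) = fun x => 1 + x * g x := by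
    funext x
    rcases eq_or_ne x 0 with rfl | hx
    · simp
    · simp only [hg]; field_simp; ring
  set A : ℕ → ℝ := fun k => C k * r k * divDiffFrom r g (n - k) k with hA
  have hterm : ∀ k < n, gelfond r n k t = A k - A (k + 1) := by
    intro k hk
    obtain ⟨N, hN⟩ : ∃ N, n - k = N + 1 := ⟨n - k - 1, by omega⟩
    have hN' : n - (k + 1) = N := by omega
    rw [gelfond_eq_divDiffFrom, htg, divDiffFrom_add, divDiffFrom_one, if_neg (by omega)]
    change C k * _ = _
    simp only [hA]
    rw [hN, hN', divDiffFrom_id_mul hr g N k (by omega)]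
    linear_combination divDiffFrom r g N (k + 1) * hCs k hk
  have hlast : gelfond r n n t = 1 + A n := by
    simp only [hA, hCn, gelfond, if_true, Nat.sub_self, divDiffFrom_zero, one_mul]
    exact congrFun htg (r n)
  rw [Finset.sum_range_succ, Finset.sum_congr rfl fun k hk => hterm k (Finset.mem_range.1 hk),
    Finset.sum_range_sub', hlast]
  simp [hA, hr0]

lemma rpow_eq_exp_mul_log {t : ℝ} (ht : 0 < t) (x : ℝ) :
    t ^ x = Real.exp (x * Real.log t) := by
  rw [Real.rpow_def_of_pos ht, mul_comm]

/-- A Gelfond–Bernstein function is a Müntz polynomial with a zero of order `n - j` at `1`. -/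
lemma exists_gelfond_coeff (hr : ∀ i < n, r i < r (i + 1)) (hr0 : r 0 = 0) {j : ℕ} (hj : j ≤ n) :
    ∃ h : ℕ → ℝ, (∀ i < j, h i = 0) ∧
      (∀ t, 0 < t → gelfond r n j t = expSum r h n 0 (Real.log t)) ∧
      (∀ m < n - j, expSum r h n m 0 = 0) ∧ 0 < (-1) ^ (n - j) * expSum r h n (n - j) 0 := by
  obtain ⟨d, hd, hd'⟩ := exists_divDiffFrom_weights (r := r) (n := n) (n - j) j (by omega)
  set C : ℝ := ∏ i ∈ Finset.Icc (j + 1) n, r i with hC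
  have hC0 : 0 < C := Finset.prod_pos fun i hi => by
    rw [Finset.mem_Icc] at hi
    exact hr0 ▸ lt_of_step_lt hr (by omega : 0 < i) hi.2
  have hS : ∀ m, expSum r (fun p => (-1) ^ (n - j) * C * d p) n m 0 =
      (-1) ^ (n - j) * C * divDiffFrom r (fun x => x ^ m) (n - j) j := by
    intro m
    rw [hd', expSum, Finset.mul_sum]
    exact Finset.sum_congr rfl fun _ _ => by rw [mul_zero, Real.exp_zero]; ring
  refine ⟨fun p => (-1) ^ (n - j) * C * d p, fun i hi => by simp [hd i hi], fun t ht => ?_,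
    fun m hm => ?_, ?_⟩
  · rw [gelfond_eq_divDiffFrom, hd', expSum, Finset.mul_sum]
    exact Finset.sum_congr rfl fun p _ => by rw [rpow_eq_exp_mul_log ht]; ring
  · rw [hS, divDiffFrom_pow hr m _ _ hm.le (by omega), if_neg hm.ne, mul_zero]
  · rw [hS, divDiffFrom_pow hr _ _ _ le_rfl (by omega), if_pos rfl, mul_one, ← mul_assoc,
      ← mul_pow]
    simpa using hC0

end DividedDifference

section Muntz

variable {r : ℕ → ℝ} {n : ℕ}

lemma iteratedDeriv_muntz {f : ℝ → ℝ} {c : ℕ → ℝ}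
    (hf : ∀ t, 0 < t → f t = ∑ j ∈ Finset.range (n + 1), c j * t ^ r j) (m : ℕ) :
    ∀ t, 0 < t → iteratedDeriv m f t =
      ∑ j ∈ Finset.range (n + 1), c j * (descPochhammer ℝ m).eval (r j) * t ^ (r j - m) := by
  induction m with
  | zero => simpa using hf
  | succ m ih =>
    intro t ht
    rw [iteratedDeriv_succ]
    have he : iteratedDeriv m f =ᶠ[𝓝 t] fun t => ∑ j ∈ Finset.range (n + 1),
        c j * (descPochhammer ℝ m).eval (r j) * t ^ (r j - m) :=
      (eventually_gt_nhds ht).mono ih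
    rw [he.deriv_eq]
    refine (HasDerivAt.fun_sum fun j _ =>
      (Real.hasDerivAt_rpow_const (Or.inl ht.ne')).const_mul _).deriv.trans
      (Finset.sum_congr rfl fun j _ => ?_)
    rw [descPochhammer_succ_eval]
    push_cast
    rw [sub_add_eq_sub_sub]
    ring

lemma sum_mul_eval_eq_zero {w : ℕ → ℝ} {S : Finset ℕ} {k : ℕ}
    (h : ∀ m < k, ∑ j ∈ S, w j * (descPochhammer ℝ m).eval (r j) = 0) :
    ∀ m ≤ k, ∀ p : Polynomial ℝ, p.degree < m → ∑ j ∈ S, w j * p.eval (r j) = 0 := by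
  intro m
  induction m with
  | zero =>
    intro _ p hp
    have : p = 0 := by simpa using hp
    simp [this]
  | succ m ih =>
    intro hm p hp
    set q := descPochhammer ℝ m with hq
    have hqm : q.natDegree = m := descPochhammer_natDegree _ _
    have hmon : q.Monic := monic_descPochhammer ℝ m
    have hlt : (p - Polynomial.C (p.coeff m) * q).degree < m := by
      rw [Polynomial.degree_lt_iff_coeff_zero]
      intro i hi
      rw [Polynomial.coeff_sub, Polynomial.coeff_C_mul]
      rcases hi.lt_or_eq with hi | rfl
      · rw [Polynomial.coeff_eq_zero_of_degree_lt (hp.trans_le (by exact_mod_cast hi)),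
          Polynomial.coeff_eq_zero_of_natDegree_lt (p := q) (by omega), mul_zero, sub_zero]
      · have : q.coeff m = 1 := by simpa [hqm] using hmon.coeff_natDegree
        rw [this, mul_one, sub_self]
    have h1 := ih (by omega) _ hlt
    have h2 := h m (by omega)
    simp only [Polynomial.eval_sub, Polynomial.eval_mul, Polynomial.eval_C] at h1
    calc ∑ j ∈ S, w j * p.eval (r j)
        = ∑ j ∈ S, w j * (p.eval (r j) - p.coeff m * q.eval (r j)) +
          p.coeff m * ∑ j ∈ S, w j * q.eval (r j) := by
          rw [Finset.mul_sum, ← Finset.sum_add_distrib]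
          exact Finset.sum_congr rfl fun _ _ => by ring
      _ = 0 := by rw [h1, h2]; ring

lemma expSum_log_eq_zero_of_iteratedDeriv {f : ℝ → ℝ} {c : ℕ → ℝ}
    (hf : ∀ t, 0 < t → f t = ∑ j ∈ Finset.range (n + 1), c j * t ^ r j) {t : ℝ} (ht : 0 < t)
    {k : ℕ} (h : ∀ m < k, iteratedDeriv m f t = 0) :
    ∀ m < k, expSum r c n m (Real.log t) = 0 := by
  intro m hm
  have h0 : ∀ m < k, ∑ j ∈ Finset.range (n + 1),
      (c j * t ^ r j) * (descPochhammer ℝ m).eval (r j) = 0 := by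
    intro m hm
    have h1 := h m hm
    rw [iteratedDeriv_muntz hf m t ht] at h1
    have h2 : (∑ j ∈ Finset.range (n + 1),
        (c j * t ^ r j) * (descPochhammer ℝ m).eval (r j)) / t ^ (m : ℝ) = 0 := by
      rw [← h1, Finset.sum_div]
      exact Finset.sum_congr rfl fun j _ => by rw [Real.rpow_sub ht]; ring
    exact (div_eq_zero_iff.1 h2).resolve_right (Real.rpow_pos_of_pos ht _).ne'
  have h1 := sum_mul_eval_eq_zero h0 (m + 1) hm (Polynomial.X ^ m)
    (by rw [Polynomial.degree_X_pow]; exact_mod_cast Nat.lt_succ_self m)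
  rw [← h1, expSum]
  exact Finset.sum_congr rfl fun j _ => by
    rw [rpow_eq_exp_mul_log ht, Polynomial.eval_pow, Polynomial.eval_X]; ring

end Muntz

/-- The Chebyshev–Bézier control points on `[a,1]` of any element of `E(Λ_n)` are convex
combinations, with coefficients independent of the element, of its Gelfond–Bézier control
points on `[0,1]`. -/
theorem chebBezier_convex_combination_of_gelfondBezier (r : ℕ → ℝ) (n : ℕ) (hr0 : r 0 = 0)
    (hmono : ∀ i, i < n → r i < r (i + 1)) (a : ℝ) (ha : 0 < a) (ha1 : a < 1)
    (B : ℕ → ℝ → ℝ) (hB : IsChebBernstein r n a 1 B) :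
    ∀ i ≤ n, ∃ s : ℕ → ℝ, (∀ j ≤ n, s j ∈ Set.Icc (0:ℝ) 1) ∧
      (∑ j ∈ Finset.range (n + 1), s j = 1) ∧
      ∀ (σ : ℕ), 1 ≤ σ → ∀ P b : ℕ → EuclideanSpace ℝ (Fin σ),
        (∀ t ∈ Set.Icc a 1,
          ∑ k ∈ Finset.range (n + 1), gelfond r n k t • P k =
            ∑ k ∈ Finset.range (n + 1), B k t • b k) →
        b i = ∑ j ∈ Finset.range (n + 1), s j • P j := by
  intro i hi
  obtain ⟨hBm, hB1, hBa, hBb⟩ := hB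
  have hr : ∀ i < n, r i < r (i + 1) := hmono
  set α := Real.log a with hα
  have hα0 : α < 0 := Real.log_neg ha ha1
  have hexp : ∀ u ∈ Set.Icc α 0, Real.exp u ∈ Set.Icc a 1 := fun u hu =>
    ⟨(Real.log_le_iff_le_exp ha).1 hu.1, Real.exp_le_one_iff.2 hu.2⟩
  have hBm' : ∀ k, ∃ c : ℕ → ℝ, k ≤ n → ∀ t, 0 < t →
      B k t = ∑ j ∈ Finset.range (n + 1), c j * t ^ r j := fun k => by
    by_cases hk : k ≤ n
    · obtain ⟨c, hc⟩ := hBm k hk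
      exact ⟨c, fun _ => hc⟩
    · exact ⟨0, fun h => absurd h hk⟩
  choose b hb using hBm'
  have hbB : ∀ k ≤ n, ∀ u, B k (Real.exp u) = expSum r (b k) n 0 u := by
    intro k hk u
    rw [hb k hk _ (Real.exp_pos u), expSum]
    exact Finset.sum_congr rfl fun j _ => by
      rw [rpow_eq_exp_mul_log (Real.exp_pos u), Real.log_exp]; ring
  have hbα : ∀ k ≤ n, ∀ m < k, expSum r (b k) n m α = 0 := fun k hk =>
    expSum_log_eq_zero_of_iteratedDeriv (hb k hk) ha (hBa k hk)
  have hb0 : ∀ k ≤ n, ∀ m < n - k, expSum r (b k) n m 0 = 0 := fun k hk m hm => by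
    have := expSum_log_eq_zero_of_iteratedDeriv (hb k hk) one_pos (hBb k hk) m hm
    rwa [Real.log_one] at this
  have hcomb : ∀ (x : ℕ → ℝ) (u : ℝ),
      expSum r (fun p => ∑ k ∈ Finset.range (n + 1), x k * b k p) n 0 u =
        ∑ k ∈ Finset.range (n + 1), x k * B k (Real.exp u) := by
    intro x u
    rw [expSum_sum_mul]
    exact Finset.sum_congr rfl fun k hk => by
      rw [hbB k (Nat.lt_succ_iff.1 (Finset.mem_range.1 hk))]
  have hb1 : ∀ p ≤ n, ∑ k ∈ Finset.range (n + 1), b k p = if p = 0 then 1 else 0 := by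
    intro p hp
    have h := coeff_eq_zero_of_eqOn_zero (c := fun p =>
      (∑ k ∈ Finset.range (n + 1), 1 * b k p) - 1 * if p = 0 then 1 else 0) hr hα0
      (fun u hu => by
        rw [expSum_sub_mul, hcomb]
        simp only [one_mul]
        rw [hB1 _ (hexp u hu), expSum, Finset.sum_range_succ', Finset.sum_eq_zero]
        · simp [hr0]
        · simp) p hp
    simpa [sub_eq_zero] using h
  have hbpos := bernstein_pos hr hr0 hα0 hbα hb0 hb1
  have hindep : ∀ x : ℕ → ℝ, (∀ t ∈ Set.Icc a 1, ∑ k ∈ Finset.range (n + 1), x k * B k t = 0) →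
      ∀ k ≤ n, x k = 0 := fun x hx =>
    bernstein_independent hbα hbpos (coeff_eq_zero_of_eqOn_zero hr hα0 fun u hu => by
      rw [hcomb]; exact hx _ (hexp u hu))
  have hS : ∀ j, ∃ s : ℕ → ℝ, j ≤ n → (∀ i, 0 ≤ s i) ∧ ∀ t, 0 < t →
      gelfond r n j t = ∑ k ∈ Finset.range (n + 1), s k * B k t := by
    intro j
    by_cases hj : j ≤ n
    · obtain ⟨h, hh, hg, hv, hp⟩ := exists_gelfond_coeff hr hr0 hj
      obtain ⟨s, hs, hs'⟩ := exists_nonneg_combination hr hα0 hbα hb0 hbpos j 0 (n - j)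
        (by omega) h hh (by simp) hv
        (endpoint_sign_symm hr hα0 (by omega) hh (by simp) hv hp)
      refine ⟨s, fun _ => ⟨hs, fun t ht => ?_⟩⟩
      rw [hg t ht, ← Real.exp_log ht, ← hcomb, Real.log_exp]
      exact Finset.sum_congr rfl fun p hp => by
        rw [hs' p (Nat.lt_succ_iff.1 (Finset.mem_range.1 hp))]
    · exact ⟨0, fun h => absurd h hj⟩
  choose s hs using hS
  have hexpand : ∀ (y : ℕ → ℝ) (t : ℝ), 0 < t →
      ∑ j ∈ Finset.range (n + 1), gelfond r n j t * y j =
        ∑ k ∈ Finset.range (n + 1), (∑ j ∈ Finset.range (n + 1), s j k * y j) * B k t := by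
    intro y t ht
    simp only [Finset.sum_mul]
    rw [Finset.sum_comm]
    refine Finset.sum_congr rfl fun j hj => ?_
    rw [(hs j (Nat.lt_succ_iff.1 (Finset.mem_range.1 hj))).2 t ht, Finset.sum_mul]
    exact Finset.sum_congr rfl fun _ _ => by ring
  have hunique : ∀ y z : ℕ → ℝ, (∀ t ∈ Set.Icc a 1,
      ∑ j ∈ Finset.range (n + 1), gelfond r n j t * y j =
        ∑ k ∈ Finset.range (n + 1), B k t * z k) →
      z i = ∑ j ∈ Finset.range (n + 1), s j i * y j := by
    intro y z h
    refine (sub_eq_zero.1 (hindep (fun k => (∑ j ∈ Finset.range (n + 1), s j k * y j) - z k)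
      (fun t ht => ?_) i hi)).symm
    simp only [sub_mul, Finset.sum_sub_distrib]
    rw [← hexpand y t (ha.trans_le ht.1), h t ht, sub_eq_zero]
    exact Finset.sum_congr rfl fun _ _ => mul_comm _ _
  have hsum : ∑ j ∈ Finset.range (n + 1), s j i = 1 := by
    have h := hunique (fun _ => 1) (fun _ => 1) fun t ht => by
      simp only [mul_one]
      rw [hB1 t ht, sum_gelfond hr hr0 t]
    simpa using h.symm
  have hs0 : ∀ j ≤ n, 0 ≤ s j i := fun j hj => (hs j hj).1 i
  refine ⟨fun j => s j i, fun j hj => ⟨hs0 j hj, ?_⟩, hsum, ?_⟩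
  · rw [← hsum]
    exact Finset.single_le_sum (f := fun j => s j i)
      (fun j hj => hs0 j (Nat.lt_succ_iff.1 (Finset.mem_range.1 hj)))
      (Finset.mem_range.2 (Nat.lt_succ_of_le hj))
  · intro σ _ P z h
    ext d
    have h' := hunique (fun j => P j d) (fun j => z j d) fun t ht => by
      simpa using congrArg (fun v : EuclideanSpace ℝ (Fin σ) => v d) (h t ht)
    simpa using h'
end
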